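/- Fix α ∈ ℕ^m and β ∈ ℕ^{m'}, and for each partition μ of n let χ_{α,β}(μ) denote the trace of the action of a permutation of cycle type μ on the homogeneous component R_{α,β} (this is a well-defined integer). Then for every positive integer N, the following identity holds in the polynomial ring ℚ[y_1,…,y_N]: Σ_{μ ⊢ n} χ_{α,β}(μ)·p_μ/z_μ = Σ_π h_{n−ℓ(π)}·h_{m̃e(π)}·e_{m̃o(π)}, where the right-hand sum runs over all multiset partitions π of content cont_{α,β} = {1^{α_1},…,m^{α_m},1̄^{β_1},…,m̄'^{β_{m'}}} with ℓ(π) ≤ n. -/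

import Mathlib

set_option maxHeartbeats 1000000
set_option synthInstance.maxHeartbeats 400000

open scoped TensorProduct

/-- A colored multiset in the alphabet `{1,…,m} ∪ {1̄,…,m̄'}`: the function records the
multiplicity of each unbarred entry, the finset records the (unrepeated) barred entries. -/
abbrev CMS (m m' : ℕ) := (Fin m → ℕ) × Finset (Fin m')

/-- The size `|S|` of a colored multiset. -/
def CMS.size {m m' : ℕ} (S : CMS m m') : ℕ := (∑ j, S.1 j) + S.2.card

/-- The ring `ℂ[X_{n×m}; Θ_{n×m'}]`. -/
abbrev R (n m m' : ℕ) := MvPolynomial (Fin n × Fin m) ℂ ⊗[ℂ] ExteriorAlgebra ℂ ((Fin n × Fin m') → ℂ)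

/-- The anticommuting generator `θ_{ij'}`. -/
noncomputable def theta (n m m' : ℕ) (i : Fin n) (j' : Fin m') : R n m m' :=
  1 ⊗ₜ ExteriorAlgebra.ι ℂ (Pi.single (i, j') 1)

/-- The monomial `x_{r1}^{a_1}⋯x_{rm}^{a_m}·θ_{r s_1}⋯θ_{r s_k}` attached to a row `r` and a
colored multiset `S` (the `θ`-factors taken in increasing order of the barred indices). -/
noncomputable def mon (n m m' : ℕ) (r : Fin n) (S : CMS m m') : R n m m' :=
  ((∏ j, MvPolynomial.X (r, j) ^ S.1 j : MvPolynomial (Fin n × Fin m) ℂ) ⊗ₜ[ℂ] 1) *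
    ((S.2.sort (· ≤ ·)).map (fun j' => theta n m m' r j')).prod

/-- The power sum generator `p_S`. -/
noncomputable def pS (n : ℕ) {m m' : ℕ} (S : CMS m m') : R n m m' :=
  ∑ r : Fin n, mon n m m' r S

/-- The action of `σ ∈ S_n` on `R` by algebra automorphisms, `σ·x_{ij} = x_{σ(i)j}` and
`σ·θ_{ij'} = θ_{σ(i)j'}`. -/
noncomputable def act {n m m' : ℕ} (σ : Equiv.Perm (Fin n)) : R n m m' →ₐ[ℂ] R n m m' :=
  Algebra.TensorProduct.map
    (MvPolynomial.rename (fun p => (σ p.1, p.2)))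
    (ExteriorAlgebra.map (LinearMap.funLeft ℂ ℂ (fun p => (σ⁻¹ p.1, p.2))))

/-- The product of the generators `θ_p` over a finite set `E` of indices (in some fixed order). -/
noncomputable def thetaMon (n m' : ℕ) (E : Finset (Fin n × Fin m')) :
    ExteriorAlgebra ℂ ((Fin n × Fin m') → ℂ) :=
  (E.toList.map (fun p => ExteriorAlgebra.ι ℂ (Pi.single p 1))).prod

/-- The homogeneous component `R_{α,β}` of `R`: the span of the products of generators of
total degree `α_j` in `x_{1j},…,x_{nj}` for each `j` and total degree `β_{j'}` in
`θ_{1j'},…,θ_{nj'}` for each `j'`. -/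
noncomputable def component (n m m' : ℕ) (α : Fin m → ℕ) (β : Fin m' → ℕ) :
    Submodule ℂ (R n m m') :=
  Submodule.span ℂ
    {z : R n m m' | ∃ (d : (Fin n × Fin m) →₀ ℕ) (E : Finset (Fin n × Fin m')),
      (∀ j, (∑ i, d (i, j)) = α j) ∧
      (∀ j', (E.filter (fun p => p.2 = j')).card = β j') ∧
      z = (MvPolynomial.monomial d 1) ⊗ₜ[ℂ] thetaMon n m' E}

/-- `π` has content `cont_{α,β} = {1^{α_1},…,m^{α_m},1̄^{β_1},…,m̄'^{β_{m'}}}`. -/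
def ContentIs {m m' : ℕ} (π : Multiset (CMS m m')) (α : Fin m → ℕ) (β : Fin m' → ℕ) : Prop :=
  (∀ j, (π.map (fun P => P.1 j)).sum = α j) ∧
    (∀ j', (π.map (fun P => if j' ∈ P.2 then 1 else 0)).sum = β j')

/-- The power sum `p_r = y_1^r + ⋯ + y_N^r` in `ℚ[y_1,…,y_N]`. -/
noncomputable def pN (N r : ℕ) : MvPolynomial (Fin N) ℚ :=
  ∑ i, MvPolynomial.X i ^ r

/-- The complete homogeneous symmetric polynomial `h_a` in `ℚ[y_1,…,y_N]`. -/
noncomputable def hN (N a : ℕ) : MvPolynomial (Fin N) ℚ :=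
  ∑ s : Sym (Fin N) a, ((s : Multiset (Fin N)).map MvPolynomial.X).prod

/-- The elementary symmetric polynomial `e_b` in `ℚ[y_1,…,y_N]`. -/
noncomputable def eN (N b : ℕ) : MvPolynomial (Fin N) ℚ :=
  ∑ E ∈ Finset.univ.powersetCard b, ∏ i ∈ E, MvPolynomial.X i

/-- `z_μ = ∏_i i^{c_i}·c_i!` where `c_i` is the number of parts of `μ` equal to `i`. -/
def zPart {k : ℕ} (μ : k.Partition) : ℕ :=
  ∏ i ∈ μ.parts.toFinset, i ^ μ.parts.count i * Nat.factorial (μ.parts.count i)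


noncomputable def phiAlt {P : Type} [DecidableEq P] (L : List P) (i : ℕ) : (P → ℂ) [⋀^Fin i]→ₗ[ℂ] ℂ :=
  if h : i = L.length then
    (Matrix.detRowAlternating (n := Fin i) (R := ℂ)).compLinearMap
      (LinearMap.funLeft ℂ ℂ (fun j : Fin i => L.get (Fin.cast h j)))
  else 0

noncomputable def phi {P : Type} [DecidableEq P] (L : List P) : ExteriorAlgebra ℂ (P → ℂ) →ₗ[ℂ] ℂ :=
  ExteriorAlgebra.liftAlternating (R := ℂ) (phiAlt L)

lemma phi_apply {P Q: Type} [DecidableEq P] (L : List P) (L' : List Q) (v : Q → (P → ℂ)) (h : L'.length = L.length) :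
    phi L ((L'.map (fun p => ExteriorAlgebra.ι ℂ (v p))).prod) =
      Matrix.det (Matrix.of fun (i j : Fin L'.length) => v (L'.get i) (L.get (Fin.cast h j))) := by
  have : (L'.map (fun p => ExteriorAlgebra.ι ℂ (v p))).prod = ExteriorAlgebra.ιMulti ℂ L'.length (fun i => v (L'.get i)) := by
    rw [ExteriorAlgebra.ιMulti_apply]
    congr 1
    conv_lhs => rw [← List.ofFn_get L']
    rw [List.map_ofFn]; rfl
  rw [this, phi, ExteriorAlgebra.liftAlternating_apply_ιMulti, phiAlt, dif_pos h]
  rfl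

lemma phi_apply_ne {P Q: Type} [DecidableEq P] (L : List P) (L' : List Q) (v : Q → (P → ℂ)) (h : L'.length ≠ L.length) :
    phi L ((L'.map (fun p => ExteriorAlgebra.ι ℂ (v p))).prod) = 0 := by
  have : (L'.map (fun p => ExteriorAlgebra.ι ℂ (v p))).prod = ExteriorAlgebra.ιMulti ℂ L'.length (fun i => v (L'.get i)) := by
    rw [ExteriorAlgebra.ιMulti_apply]
    congr 1
    conv_lhs => rw [← List.ofFn_get L']
    rw [List.map_ofFn]; rfl
  rw [this, phi, ExteriorAlgebra.liftAlternating_apply_ιMulti, phiAlt, dif_neg h]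
  rfl

lemma phi_ne {P : Type} [DecidableEq P] (E E' : Finset P) (h : E' ≠ E) :
    phi E.toList ((E'.toList.map (fun p => ExteriorAlgebra.ι ℂ (Pi.single p 1))).prod) = 0 := by
  by_cases hl : E'.toList.length = E.toList.length
  · rw [phi_apply _ _ (fun p => Pi.single p 1) hl]
    have hc : E'.card = E.card := by simpa using hl
    have : ¬ E ⊆ E' := fun hs => h (Finset.eq_of_subset_of_card_le hs hc.le).symm
    obtain ⟨q, hq, hq'⟩ := Finset.not_subset.1 this
    obtain ⟨j, hj⟩ := List.mem_iff_get.1 (Finset.mem_toList.2 hq)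
    apply Matrix.det_eq_zero_of_column_eq_zero (Fin.cast hl.symm j)
    intro i
    simp only [Matrix.of_apply]
    rw [Pi.single_apply, if_neg]
    intro he
    have h2 : E.toList.get (Fin.cast hl (Fin.cast hl.symm j)) = q := hj
    rw [h2] at he
    exact hq' (he ▸ Finset.mem_toList.1 (List.get_mem _ _))
  · exact phi_apply_ne _ _ _ hl

open Classical in
lemma phi_perm {P : Type} [DecidableEq P] (E : Finset P) (ρ : Equiv.Perm P) :
    phi E.toList ((E.toList.map (fun p => ExteriorAlgebra.ι ℂ (Pi.single (ρ p) 1))).prod) =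
    if h : ∀ p, ρ p ∈ E ↔ p ∈ E then
      ((Equiv.Perm.sign (ρ.subtypePerm (p := fun x => x ∈ E) h) : ℤ) : ℂ) else 0 := by
  rw [phi_apply _ _ (fun p => Pi.single (ρ p) 1) rfl]
  split_ifs with h
  · have e := (E.nodup_toList.getEquiv E.toList).trans
      (Equiv.subtypeEquivRight (fun x => Finset.mem_toList (s := E)))
    let e : Fin E.toList.length ≃ {x // x ∈ E} := (E.nodup_toList.getEquiv E.toList).trans
      (Equiv.subtypeEquivRight (fun x => Finset.mem_toList (s := E)))
    have he : ∀ i, (e i : P) = E.toList.get i := fun i => rfl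
    rw [← Matrix.det_permutation, ← Matrix.det_submatrix_equiv_self e]
    congr 1
    ext i j
    simp only [Matrix.of_apply, Matrix.submatrix_apply, Equiv.Perm.permMatrix, PEquiv.toMatrix_apply, Equiv.toPEquiv_apply, Option.mem_def, Option.some.injEq, Subtype.ext_iff, Equiv.Perm.subtypePerm_apply, he, Pi.single_apply]
    simp [eq_comm]
  · have : ∃ p ∈ E, ρ p ∉ E := by
      by_contra hcon
      push Not at hcon
      apply h
      intro p
      refine ⟨fun hp => ?_, hcon p⟩
      have hm : E.map ρ.toEmbedding = E := by
        apply Finset.eq_of_subset_of_card_le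
        · intro x hx
          obtain ⟨y, hy, rfl⟩ := Finset.mem_map.1 hx
          exact hcon y hy
        · simp
      rw [← hm] at hp
      simpa using hp
    obtain ⟨p, hp, hp'⟩ := this
    obtain ⟨i, hi⟩ := List.mem_iff_get.1 (Finset.mem_toList.2 hp)
    apply Matrix.det_eq_zero_of_row_eq_zero i
    intro j
    simp only [Matrix.of_apply]
    rw [Pi.single_apply, if_neg]
    intro he
    rw [hi] at he
    exact hp' (he ▸ Finset.mem_toList.1 (List.get_mem _ _))


noncomputable def dF {n m m' : ℕ} (f : Fin n → CMS m m') : (Fin n × Fin m) →₀ ℕ :=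
  Finsupp.equivFunOnFinite.symm (fun p => (f p.1).1 p.2)

def EF {n m m' : ℕ} (f : Fin n → CMS m m') : Finset (Fin n × Fin m') :=
  Finset.univ.filter (fun p => p.2 ∈ (f p.1).2)

def CtIs {n m m' : ℕ} (α : Fin m → ℕ) (β : Fin m' → ℕ) (f : Fin n → CMS m m') : Prop :=
  (∀ j, ∑ i, (f i).1 j = α j) ∧ ∀ j', ∑ i, (if j' ∈ (f i).2 then 1 else 0) = β j'

abbrev XX (n : ℕ) {m m' : ℕ} (α : Fin m → ℕ) (β : Fin m' → ℕ) := {f : Fin n → CMS m m' // CtIs α β f}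

instance finiteXX (n : ℕ) {m m' : ℕ} (α : Fin m → ℕ) (β : Fin m' → ℕ) : Finite (XX n α β) := by
  have h1 : (Set.Iic α ×ˢ (Set.univ : Set (Finset (Fin m')))).Finite :=
    (Set.finite_Iic α).prod Set.finite_univ
  have h2 := Set.Finite.pi' (ι := Fin n) (t := fun _ => Set.Iic α ×ˢ (Set.univ : Set (Finset (Fin m')))) (fun _ => h1)
  refine Set.Finite.to_subtype (s := {f | CtIs α β f}) (h2.subset ?_)
  intro f hf i
  refine ⟨fun j => ?_, trivial⟩
  rw [← hf.1 j]
  exact Finset.single_le_sum (f := fun i => (f i).1 j) (fun _ _ => Nat.zero_le _) (Finset.mem_univ i)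

noncomputable instance fintypeXX (n : ℕ) {m m' : ℕ} (α : Fin m → ℕ) (β : Fin m' → ℕ) : Fintype (XX n α β) :=
  Fintype.ofFinite _

noncomputable def bvec {n m m' : ℕ} (f : Fin n → CMS m m') : R n m m' :=
  (MvPolynomial.monomial (dF f) 1) ⊗ₜ[ℂ] thetaMon n m' (EF f)

noncomputable def psi {n m m' : ℕ} (f : Fin n → CMS m m') : R n m m' →ₗ[ℂ] ℂ :=
  (LinearMap.mul' ℂ ℂ) ∘ₗ TensorProduct.map (MvPolynomial.lcoeff ℂ (dF f)) (phi (EF f).toList)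

def rho {n : ℕ} (m' : ℕ) (σ : Equiv.Perm (Fin n)) : Equiv.Perm (Fin n × Fin m') :=
  σ.prodCongr (Equiv.refl _)

open Classical in
noncomputable def sgn {n m m' : ℕ} (σ : Equiv.Perm (Fin n)) (f : Fin n → CMS m m') : ℤ :=
  if h : ∀ p, rho m' σ p ∈ EF f ↔ p ∈ EF f then
      ((Equiv.Perm.sign ((rho m' σ).subtypePerm (p := fun x => x ∈ EF f) h) : ℤ)) else 0

lemma f_ext {n m m' : ℕ} {f g : Fin n → CMS m m'} (h1 : dF f = dF g) (h2 : EF f = EF g) : f = g := by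
  funext i
  apply Prod.ext
  · funext j
    exact DFunLike.congr_fun h1 (i, j)
  · ext j
    have := Finset.ext_iff.1 h2 (i, j)
    simpa [EF] using this

lemma component_eq (n m m' : ℕ) (α : Fin m → ℕ) (β : Fin m' → ℕ) :
    component n m m' α β = Submodule.span ℂ (Set.range (fun f : XX n α β => bvec f.1)) := by
  unfold component
  congr 1
  ext z
  have hE : ∀ (f : Fin n → CMS m m') j', ((EF f).filter (fun p => p.2 = j')).card = ∑ i, (if j' ∈ (f i).2 then 1 else 0) := by
    intro f j'
    rw [← Finset.card_filter]
    apply Finset.card_bij' (fun p _ => p.1) (fun i _ => (i, j'))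
    all_goals simp +contextual [EF]
    try aesop
  constructor
  · rintro ⟨d, E, h1, h2, rfl⟩
    let f : Fin n → CMS m m' := fun i => (fun j => d (i, j), Finset.univ.filter (fun j' => (i, j') ∈ E))
    have hd : dF f = d := by ext p; rfl
    have hE' : EF f = E := by ext p; simp [EF, f]
    refine ⟨⟨f, h1, fun j' => ?_⟩, ?_⟩
    · rw [← hE, hE', h2]
    · simp only [bvec, hd, hE']
  · rintro ⟨f, rfl⟩
    refine ⟨dF f.1, EF f.1, f.2.1, fun j' => ?_, rfl⟩
    rw [hE, f.2.2]

open Classical in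
lemma psi_bvec {n m m' : ℕ} (f g : Fin n → CMS m m') : psi f (bvec g) = if g = f then 1 else 0 := by
  simp only [psi, bvec, LinearMap.comp_apply, TensorProduct.map_tmul, LinearMap.mul'_apply, MvPolynomial.lcoeff_apply, MvPolynomial.coeff_monomial]
  split_ifs with h1 h2 h2
  · subst h2
    have := phi_perm (EF g) 1
    rw [dif_pos (by simp)] at this
    simp only [Equiv.Perm.coe_one, id] at this
    rw [thetaMon, this]
    have h1 : Equiv.Perm.subtypePerm (p := fun x => x ∈ EF g) 1 (by simp) = 1 := by apply Equiv.ext; intro x; rfl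
    rw [h1]; simp
  · have : EF g ≠ EF f := fun h => h2 (f_ext h1 h)
    rw [thetaMon, phi_ne _ _ this, mul_zero]
  · exact absurd (h2 ▸ rfl) h1
  · simp

open Classical in
lemma psi_act {n m m' : ℕ} (σ : Equiv.Perm (Fin n)) (f : Fin n → CMS m m') :
    psi f (act σ (bvec f)) = if f ∘ σ = f then (sgn σ f : ℂ) else 0 := by
  have hact : act σ (bvec f) = (MvPolynomial.monomial ((dF f).mapDomain (σ.prodCongr (Equiv.refl (Fin m)))) (1:ℂ)) ⊗ₜ[ℂ]
     (((EF f).toList.map (fun p => ExteriorAlgebra.ι ℂ (Pi.single (rho m' σ p) (1:ℂ)))).prod) := by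
    simp only [act, bvec, Algebra.TensorProduct.map_tmul, MvPolynomial.rename_monomial, thetaMon, map_list_prod, List.map_map]
    congr 3
    funext p
    simp only [Function.comp_apply, ExteriorAlgebra.map_apply_ι]
    congr 1
    ext q
    simp only [LinearMap.funLeft_apply, Pi.single_apply, rho]
    congr 1
    simp only [Prod.ext_iff, Equiv.prodCongr_apply, Prod.map, Equiv.refl_apply, Equiv.Perm.inv_eq_iff_eq, eq_iff_iff]
  rw [hact]
  simp only [psi, LinearMap.comp_apply, TensorProduct.map_tmul, LinearMap.mul'_apply, MvPolynomial.lcoeff_apply, MvPolynomial.coeff_monomial]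
  rw [phi_perm]
  have hd : (dF f).mapDomain (σ.prodCongr (Equiv.refl (Fin m))) = dF f ↔ ∀ i, (f (σ i)).1 = (f i).1 := by
    rw [DFunLike.ext_iff]
    constructor
    · intro h i
      funext j
      have := h (σ i, j)
      rw [Finsupp.mapDomain_equiv_apply] at this
      simpa [dF, eq_comm] using this
    · rintro h ⟨i, j⟩
      rw [Finsupp.mapDomain_equiv_apply]
      have := h (σ.symm i)
      simp [dF] at this ⊢
      rw [this]
  have hE : (∀ p, rho m' σ p ∈ EF f ↔ p ∈ EF f) ↔ ∀ i, (f (σ i)).2 = (f i).2 := by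
    simp only [Finset.ext_iff, rho, EF, Prod.forall]
    simp
  by_cases hf : f ∘ σ = f
  · have hf' : ∀ i, f (σ i) = f i := fun i => congrFun hf i
    rw [if_pos hf, if_pos (hd.2 (fun i => by rw [hf'])), sgn, one_mul]
    rw [dif_pos (hE.2 (fun i => by rw [hf'])), dif_pos (hE.2 (fun i => by rw [hf']))]
  · rw [if_neg hf]
    by_cases h1 : (dF f).mapDomain (σ.prodCongr (Equiv.refl (Fin m))) = dF f
    · rw [dif_neg, mul_zero]
      intro h2
      apply hf
      funext i
      exact Prod.ext (hd.1 h1 i) (hE.1 h2 i)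
    · rw [if_neg h1, zero_mul]

open Classical in
lemma trace_eq (n m m' : ℕ) (α : Fin m → ℕ) (β : Fin m' → ℕ) (σ : Equiv.Perm (Fin n))
    (h : ∀ z ∈ component n m m' α β, @act n m m' σ z ∈ component n m m' α β) :
    LinearMap.trace ℂ (component n m m' α β)
          (LinearMap.restrict (@act n m m' σ).toLinearMap h) =
      ((∑ f : XX n α β, if f.1 ∘ σ = f.1 then sgn σ f.1 else 0 : ℤ) : ℂ) := by
  have hli : LinearIndependent ℂ (fun f : XX n α β => bvec f.1) := by
    rw [Fintype.linearIndependent_iff]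
    intro c hc f
    have := congrArg (psi f.1) hc
    simpa [map_sum, psi_bvec, ← Subtype.ext_iff] using this
  let b : Module.Basis (XX n α β) ℂ (component n m m' α β) :=
    (Module.Basis.span hli).map (LinearEquiv.ofEq _ _ (component_eq n m m' α β).symm)
  have hb : ∀ f, (b f : R n m m') = bvec f.1 := by
    intro f
    simp [b, Module.Basis.span_apply]
  have hrepr : ∀ (x : component n m m' α β) f, b.repr x f = psi f.1 x := by
    intro x f
    have : (Finsupp.lapply f) ∘ₗ b.repr.toLinearMap = psi f.1 ∘ₗ (component n m m' α β).subtype := by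
      apply b.ext
      intro g
      simp [hb, psi_bvec, Finsupp.single_apply, Subtype.ext_iff]
    exact LinearMap.congr_fun this x
  rw [LinearMap.trace_eq_matrix_trace ℂ b, Matrix.trace]
  push_cast
  apply Finset.sum_congr rfl
  intro f _
  rw [Matrix.diag_apply, LinearMap.toMatrix_apply, hrepr]
  have h3 : ((LinearMap.restrict (@act n m m' σ).toLinearMap h (b f) : component n m m' α β) : R n m m') = act σ (bvec f.1) := by
    rw [← hb]; rfl
  exact (congrArg (psi f.1) h3).trans (psi_act σ f.1)


lemma EF_stab {n m m' : ℕ} {σ : Equiv.Perm (Fin n)} {f : Fin n → CMS m m'} (h : f ∘ σ = f) :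
    ∀ p, rho m' σ p ∈ EF f ↔ p ∈ EF f := by
  intro p
  have : f (σ p.1) = f p.1 := congrFun h p.1
  simp [rho, EF, this]

lemma sgn_mul {n m m' : ℕ} {σ τ : Equiv.Perm (Fin n)} {f : Fin n → CMS m m'} (h : f ∘ σ = f)
    (h' : f ∘ τ = f) : sgn (σ * τ) f = sgn σ f * sgn τ f := by
  have h2 : f ∘ (σ * τ : Equiv.Perm (Fin n)) = f := by
    rw [Equiv.Perm.coe_mul, ← Function.comp_assoc, h, h']
  rw [sgn, sgn, sgn, dif_pos (EF_stab h), dif_pos (EF_stab h'), dif_pos (EF_stab h2)]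
  rw [← Units.val_mul, ← map_mul]
  congr 2

lemma sgn_one {n m m' : ℕ} (f : Fin n → CMS m m') : sgn 1 f = 1 := by
  rw [sgn, dif_pos (EF_stab rfl)]
  have h1 : Equiv.Perm.subtypePerm (p := fun x => x ∈ EF f) (rho m' 1) (EF_stab rfl) = 1 := by apply Equiv.ext; intro x; rfl
  rw [h1]; simp

lemma sgn_swap {n m m' : ℕ} {a b : Fin n} (hab : a ≠ b) {f : Fin n → CMS m m'} (h : f a = f b) :
    f ∘ (Equiv.swap a b) = f ∧ sgn (Equiv.swap a b) f = (-1) ^ (f a).2.card := by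
  have hs : f ∘ (Equiv.swap a b) = f := by
    funext x
    simp only [Function.comp_apply, Equiv.swap_apply_def]
    split_ifs with h1 h2
    · rw [h1, h]
    · rw [h2, h]
    · rfl
  refine ⟨hs, ?_⟩
  rw [sgn, dif_pos (EF_stab hs), ← Equiv.Perm.sign_ofSubtype]
  have : Equiv.Perm.ofSubtype (Equiv.Perm.subtypePerm (p := fun x => x ∈ EF f) (rho m' (Equiv.swap a b)) (EF_stab hs))
     = Equiv.prodCongrLeft (fun j : Fin m' => if j ∈ (f a).2 then Equiv.swap a b else 1) := by
    apply Equiv.ext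
    rintro ⟨i, j⟩
    by_cases hp : (i, j) ∈ EF f
    · rw [Equiv.Perm.ofSubtype_apply_of_mem _ hp]
      have hp' : j ∈ (f i).2 := by simpa [EF] using hp
      simp only [Equiv.Perm.subtypePerm_apply, rho, Equiv.prodCongrLeft_apply, Equiv.prodCongr_apply, Prod.map, Equiv.refl_apply]
      split_ifs with hj
      · rfl
      · rw [Equiv.swap_apply_of_ne_of_ne]
        · rfl
        · rintro rfl; exact hj hp'
        · rintro rfl; exact hj (h ▸ hp')
    · rw [Equiv.Perm.ofSubtype_apply_of_not_mem _ hp]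
      have hp' : j ∉ (f i).2 := by simpa [EF] using hp
      simp only [Equiv.prodCongrLeft_apply]
      split_ifs with hj
      · rw [Equiv.swap_apply_of_ne_of_ne]
        · rintro rfl; exact hp' hj
        · rintro rfl; exact hp' (h ▸ hj)
      · rfl
  rw [this, Equiv.Perm.sign_prodCongrLeft]
  have h2 : ∀ j : Fin m', Equiv.Perm.sign (if j ∈ (f a).2 then Equiv.swap a b else 1) = if j ∈ (f a).2 then -1 else 1 := by
    intro j; split_ifs
    · exact Equiv.Perm.sign_swap hab
    · simp
  simp only [h2]
  rw [Finset.prod_ite_mem]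
  simp

def Good {n m m' : ℕ} {W : Type} (k : Fin n → CMS m m' × W) : Prop :=
  ∀ a b, a ≠ b → k a = k b → Even (k a).1.2.card

lemma sgn_good {n m m' : ℕ} {W : Type} (k : Fin n → CMS m m' × W) (hk : Good k) :
    ∀ (c : ℕ) (σ : Equiv.Perm (Fin n)), σ.support.card ≤ c → k ∘ σ = k → sgn σ (Prod.fst ∘ k) = 1 := by
  intro c
  induction c with
  | zero =>
    intro σ hc _
    have : σ = 1 := by simpa using hc
    rw [this, sgn_one]
  | succ c ih =>
    intro σ hc hσ
    by_cases h1 : σ = 1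
    · rw [h1, sgn_one]
    obtain ⟨x, hx⟩ : ∃ x, σ x ≠ x := by
      by_contra hcon; push Not at hcon; exact h1 (Equiv.ext hcon)
    have hlt := Equiv.Perm.card_support_swap_mul hx
    have hkx : k x = k (σ x) := (congrFun hσ x).symm
    have hsk : k ∘ (Equiv.swap x (σ x)) = k := by
      funext y
      simp only [Function.comp_apply, Equiv.swap_apply_def]
      split_ifs with h1 h2
      · rw [h1, hkx]
      · rw [h2, hkx]
      · rfl
    have hstab : k ∘ (Equiv.swap x (σ x) * σ : Equiv.Perm (Fin n)) = k := by
      rw [Equiv.Perm.coe_mul, ← Function.comp_assoc, hsk, hσ]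
    have h2 := ih _ (by omega) hstab
    obtain ⟨h3, h4⟩ := sgn_swap (f := Prod.fst ∘ k) hx.symm (by simp [hkx])
    have h5 := hk _ _ hx.symm hkx
    rw [sgn_mul h3 (by rw [Function.comp_assoc, hσ]), h4] at h2
    simpa [h5.neg_one_pow] using h2

open Classical in
lemma sgn_sum {n m m' : ℕ} {W : Type} (k : Fin n → CMS m m' × W) :
    ∑ σ : Equiv.Perm (Fin n), (if k ∘ σ = k then sgn σ (Prod.fst ∘ k) else 0) =
      if Good k then ((Finset.univ.filter (fun σ : Equiv.Perm (Fin n) => k ∘ σ = k)).card : ℤ) else 0 := by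
  split_ifs with hk
  · rw [Finset.card_filter]
    push_cast
    apply Finset.sum_congr rfl
    intro σ _
    split_ifs with h
    · exact sgn_good k hk _ σ le_rfl h
    · rfl
  · unfold Good at hk
    push Not at hk
    obtain ⟨a, b, hab, hkab, hodd⟩ := hk
    obtain ⟨h3, h4⟩ := sgn_swap (f := Prod.fst ∘ k) hab (by simp [hkab])
    have hodd' : Odd ((Prod.fst ∘ k) a).2.card := by simpa using hodd
    rw [hodd'.neg_one_pow] at h4
    have hsk : k ∘ (Equiv.swap a b) = k := by
      funext y
      simp only [Function.comp_apply, Equiv.swap_apply_def]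
      split_ifs with h1 h2
      · rw [h1, hkab]
      · rw [h2, hkab]
      · rfl
    have key : ∀ σ : Equiv.Perm (Fin n), (if k ∘ (Equiv.swap a b * σ : Equiv.Perm (Fin n)) = k then sgn (Equiv.swap a b * σ) (Prod.fst ∘ k) else 0) = - (if k ∘ σ = k then sgn σ (Prod.fst ∘ k) else 0) := by
      intro σ
      rw [Equiv.Perm.coe_mul, ← Function.comp_assoc, hsk]
      split_ifs with h
      · rw [sgn_mul h3 (by rw [Function.comp_assoc, h]), h4]; ring
      · simp
    have := Equiv.sum_comp (Equiv.mulLeft (Equiv.swap a b)) (fun σ : Equiv.Perm (Fin n) => (if k ∘ σ = k then sgn σ (Prod.fst ∘ k) else 0))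
    have h6 := this.symm.trans ((Finset.sum_congr rfl (fun σ _ => key σ)).trans (Finset.sum_neg_distrib _))
    simp only at h6
    linarith


lemma exists_perm_of_map_eq {n : ℕ} {V : Type} (f g : Fin n → V)
    (h : Multiset.map f Finset.univ.val = Multiset.map g Finset.univ.val) :
    ∃ σ : Equiv.Perm (Fin n), g ∘ σ = f := by
  classical
  have hc : ∀ v, Fintype.card {a // f a = v} = Fintype.card {a // g a = v} := by
    intro v
    have := congrArg (Multiset.count v) h
    rw [Multiset.count_map, Multiset.count_map] at this
    rw [Fintype.card_subtype, Fintype.card_subtype, Finset.card, Finset.card, Finset.filter_val, Finset.filter_val]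
    simpa [eq_comm] using this
  refine ⟨Equiv.ofFiberEquiv (fun v => Fintype.equivOfCardEq (hc v)), ?_⟩
  funext a
  exact Equiv.ofFiberEquiv_map _ a

lemma zcount {n : ℕ} (μ : n.Partition) :
    (Finset.univ.filter (fun σ : Equiv.Perm (Fin n) => σ.partition.parts = μ.parts)).card * zPart μ
      = n.factorial := by
  set M := μ.parts.filter (fun i => 2 ≤ i) with hM
  have hle : ∀ i ∈ μ.parts, ¬ 2 ≤ i → i = 1 := fun i hi h => by
    have := μ.parts_pos hi; omega
  have hsplit : μ.parts = M + Multiset.replicate (n - M.sum) 1 := by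
    have h1 : μ.parts = M + μ.parts.filter (fun i => ¬ 2 ≤ i) := (Multiset.filter_add_not _ _).symm
    have h2 : μ.parts.filter (fun i => ¬ 2 ≤ i) = Multiset.replicate (μ.parts.filter (fun i => ¬ 2 ≤ i)).card 1 := by
      rw [Multiset.eq_replicate]
      refine ⟨rfl, fun b hb => ?_⟩
      rw [Multiset.mem_filter] at hb
      exact hle b hb.1 hb.2
    have h3 : n = M.sum + (μ.parts.filter (fun i => ¬ 2 ≤ i)).card := by
      have := congrArg Multiset.sum h1
      rw [Multiset.sum_add, h2, μ.parts_sum] at this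
      simpa using this
    rw [show n - M.sum = (μ.parts.filter (fun i => ¬ 2 ≤ i)).card by omega, ← h2]
    exact h1
  have hsum : M.sum ≤ n := by
    have := congrArg Multiset.sum hsplit
    rw [Multiset.sum_add, μ.parts_sum] at this
    omega
  have hiff : ∀ σ : Equiv.Perm (Fin n), σ.partition.parts = μ.parts ↔ σ.cycleType = M := by
    intro σ
    constructor
    · intro h
      rw [hM, ← h]
      exact Equiv.Perm.filter_parts_partition_eq_cycleType.symm
    · intro h
      rw [Equiv.Perm.parts_partition, hsplit, ← Equiv.Perm.sum_cycleType, h, Fintype.card_fin]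
  simp only [hiff]
  have key := Equiv.Perm.card_of_cycleType_mul_eq (Fin n) M
  rw [if_pos ⟨by simpa using hsum, fun a ha => (Multiset.mem_filter.1 ha).2⟩, Fintype.card_fin] at key
  rw [← key]
  congr 1
  have h1M : 1 ∉ M := fun h => by have := (Multiset.mem_filter.1 h).2; omega
  rw [zPart, Finset.prod_mul_distrib, ← Finset.prod_multiset_count]
  have hp : μ.parts.prod = M.prod := by rw [hsplit]; simp
  rw [hp]
  have hq : ∏ i ∈ μ.parts.toFinset, (μ.parts.count i).factorial =
      ∏ i ∈ insert 1 M.toFinset, (μ.parts.count i).factorial := by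
    apply Finset.prod_subset
    · intro i hi
      rw [Multiset.mem_toFinset] at hi
      by_cases h2 : 2 ≤ i
      · exact Finset.mem_insert_of_mem (Multiset.mem_toFinset.2 (Multiset.mem_filter.2 ⟨hi, h2⟩))
      · rw [hle i hi h2]; simp
    · intro i _ hi
      rw [Multiset.mem_toFinset] at hi
      rw [Multiset.count_eq_zero_of_notMem hi]; rfl
  rw [hq, Finset.prod_insert (by simpa using h1M)]
  have hr : ∏ i ∈ M.toFinset, (μ.parts.count i).factorial = ∏ i ∈ M.toFinset, (M.count i).factorial := by
    apply Finset.prod_congr rfl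
    intro i hi
    rw [Multiset.mem_toFinset] at hi
    rw [hM, Multiset.count_filter_of_pos (Multiset.mem_filter.1 hi).2]
  have h1 : μ.parts.count 1 = n - M.sum := by
    rw [hsplit, Multiset.count_add, Multiset.count_eq_zero_of_notMem h1M, Multiset.count_replicate_self, zero_add]
  rw [hr, h1]
  ring

open Classical in
lemma parts_prod {n : ℕ} (σ : Equiv.Perm (Fin n)) {A : Type} [CommMonoid A] (F : ℕ → A) :
    (σ.partition.parts.map F).prod =
      ∏ q : Quotient (Equiv.Perm.SameCycle.setoid σ), F (Finset.univ.filter (fun i => (Quotient.mk (Equiv.Perm.SameCycle.setoid σ) i) = q)).card := by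
  rw [Equiv.Perm.parts_partition, Multiset.map_add, Multiset.prod_add, Multiset.map_replicate, Multiset.prod_replicate, Equiv.Perm.cycleType_def, Multiset.map_map]
  have hmk : ∀ x y : Fin n, (Quotient.mk (Equiv.Perm.SameCycle.setoid σ) x = Quotient.mk (Equiv.Perm.SameCycle.setoid σ) y) ↔ σ.SameCycle x y :=
    fun x y => Quotient.eq
  rw [← Finset.prod_filter_mul_prod_filter_not Finset.univ (fun q : Quotient (Equiv.Perm.SameCycle.setoid σ) => ∃ x ∈ σ.support, Quotient.mk (Equiv.Perm.SameCycle.setoid σ) x = q)]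
  congr 1
  · symm
    change _ = Finset.prod _ _
    refine Finset.prod_bij (fun q _ => Quotient.lift (fun x => σ.cycleOf x) (fun x y (h : σ.SameCycle x y) => h.cycleOf_eq) q) ?_ ?_ ?_ ?_
    · intro q hq
      obtain ⟨x, hx, rfl⟩ := (Finset.mem_filter.1 hq).2
      exact Equiv.Perm.cycleOf_mem_cycleFactorsFinset_iff.2 hx
    · intro q hq q' hq' h
      obtain ⟨x, hx, rfl⟩ := (Finset.mem_filter.1 hq).2
      obtain ⟨y, hy, rfl⟩ := (Finset.mem_filter.1 hq').2
      replace h : σ.cycleOf x = σ.cycleOf y := h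
      rw [hmk]
      have : y ∈ (σ.cycleOf y).support := Equiv.Perm.mem_support_cycleOf_iff.2 ⟨Equiv.Perm.SameCycle.refl _ _, hy⟩
      rw [← h] at this
      exact (Equiv.Perm.mem_support_cycleOf_iff.1 this).1
    · intro c hc
      obtain ⟨a, ha⟩ := (Equiv.Perm.mem_cycleFactorsFinset_iff.1 hc).1.nonempty_support
      have h1 := Equiv.Perm.cycle_is_cycleOf ha hc
      refine ⟨Quotient.mk _ a, ?_, h1.symm⟩
      rw [Finset.mem_filter]
      exact ⟨Finset.mem_univ _, a, Equiv.Perm.cycleOf_mem_cycleFactorsFinset_iff.1 (h1 ▸ hc), rfl⟩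
    · intro q hq
      obtain ⟨x, hx, rfl⟩ := (Finset.mem_filter.1 hq).2
      change _ = F ((σ.cycleOf x).support).card
      congr 2
      ext y
      rw [Equiv.Perm.mem_support_cycleOf_iff]
      simp only [Finset.mem_filter, Finset.mem_univ, true_and, hmk, hx, and_true]
      exact Equiv.Perm.sameCycle_comm
  · rw [Fintype.card_fin, show n - σ.support.card = (σ.supportᶜ).card by rw [Finset.card_compl, Fintype.card_fin], ← Finset.prod_const]
    refine Finset.prod_bij (fun x _ => Quotient.mk _ x) ?_ ?_ ?_ ?_
    · intro x hx
      rw [Finset.mem_compl] at hx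
      rw [Finset.mem_filter]
      refine ⟨Finset.mem_univ _, ?_⟩
      rintro ⟨y, hy, h⟩
      rw [hmk] at h
      exact (Equiv.Perm.mem_support.1 hy) (h.apply_eq_self_iff.2 (Equiv.Perm.notMem_support.1 hx))
    · intro x hx y _ h
      rw [hmk] at h
      rw [Finset.mem_compl, Equiv.Perm.notMem_support] at hx
      exact h.eq_of_left hx
    · intro q hq
      obtain ⟨x, rfl⟩ := Quotient.exists_rep q
      refine ⟨x, ?_, rfl⟩
      rw [Finset.mem_compl]
      intro hx
      exact (Finset.mem_filter.1 hq).2 ⟨x, hx, rfl⟩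
    · intro x hx
      rw [Finset.mem_compl, Equiv.Perm.notMem_support] at hx
      have : Finset.univ.filter (fun i => (Quotient.mk (Equiv.Perm.SameCycle.setoid σ) i) = Quotient.mk _ x) = {x} := by
        ext y
        simp only [Finset.mem_filter, Finset.mem_univ, true_and, hmk, Finset.mem_singleton]
        exact ⟨fun h => (h.symm.eq_of_left hx).symm, fun h => h ▸ Equiv.Perm.SameCycle.refl _ _⟩
      rw [this, Finset.card_singleton]

open Classical in
lemma psum_prod {n : ℕ} (N : ℕ) (σ : Equiv.Perm (Fin n)) :
    (σ.partition.parts.map (pN N)).prod =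
      ∑ g : Fin n → Fin N, if g ∘ σ = g then ∏ i, MvPolynomial.X (R := ℚ) (g i) else 0 := by
  rw [parts_prod]
  simp only [pN]
  rw [Finset.prod_univ_sum, Fintype.piFinset_univ, ← Finset.sum_filter]
  refine Finset.sum_bij (fun h _ => fun i => h (Quotient.mk _ i)) ?_ ?_ ?_ ?_
  · intro h _
    rw [Finset.mem_filter]
    refine ⟨Finset.mem_univ _, ?_⟩
    funext i
    simp only [Function.comp_apply]
    congr 1
    apply Quotient.sound
    exact (Equiv.Perm.sameCycle_apply_left.2 (Equiv.Perm.SameCycle.refl _ _))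
  · intro h _ h' _ he
    funext q
    obtain ⟨x, rfl⟩ := Quotient.exists_rep q
    exact congrFun he x
  · intro g hg
    have hg' : ∀ i, g (σ i) = g i := fun i => congrFun (Finset.mem_filter.1 hg).2 i
    have hpow : ∀ (k : ℕ) i, g ((σ ^ k) i) = g i := by
      intro k
      induction k with
      | zero => intro i; simp
      | succ k ih => intro i; rw [pow_succ', Equiv.Perm.mul_apply, hg', ih]
    refine ⟨Quotient.lift g (fun x y (h : σ.SameCycle x y) => ?_), Finset.mem_univ _, rfl⟩
    obtain ⟨k, hk⟩ := h.exists_nat_pow_eq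
    rw [← hk, hpow]
  · intro h _
    rw [← Finset.prod_fiberwise Finset.univ (fun i => Quotient.mk (Equiv.Perm.SameCycle.setoid σ) i)]
    apply Finset.prod_congr rfl
    intro q _
    rw [← Finset.prod_const]
    apply Finset.prod_congr rfl
    intro i hi
    simp only [(Finset.mem_filter.1 hi).2]


abbrev ms {n : ℕ} {V : Type} (k : Fin n → V) : Multiset V := Finset.univ.val.map k

lemma ms_comp {n : ℕ} {V : Type} (k : Fin n → V) (σ : Equiv.Perm (Fin n)) : ms (k ∘ σ) = ms k := by
  unfold ms
  rw [← Multiset.map_map, Multiset.map_univ_val_equiv σ]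

open Classical in
lemma orbit_count {n : ℕ} {V A : Type} [AddCommMonoid A] (s : Finset (Fin n → V))
    (hs : ∀ k ∈ s, ∀ σ : Equiv.Perm (Fin n), k ∘ σ ∈ s) (w : Multiset V → A) :
    ∑ k ∈ s, (Finset.univ.filter (fun σ : Equiv.Perm (Fin n) => k ∘ σ = k)).card • w (ms k) =
      n.factorial • ∑ K ∈ s.image ms, w K := by
  rw [← Finset.sum_fiberwise_of_maps_to (g := ms) (t := s.image ms) (fun k hk => Finset.mem_image_of_mem _ hk),
    Finset.smul_sum]
  apply Finset.sum_congr rfl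
  intro K hK
  obtain ⟨k0, hk0, rfl⟩ := Finset.mem_image.1 hK
  have h1 : ∑ k ∈ s with ms k = ms k0, (Finset.univ.filter (fun σ : Equiv.Perm (Fin n) => k ∘ σ = k)).card • w (ms k)
     = ∑ k ∈ s with ms k = ms k0, (Finset.univ.filter (fun σ : Equiv.Perm (Fin n) => k0 ∘ σ = k)).card • w (ms k0) := by
    apply Finset.sum_congr rfl
    intro k hk
    have hk' := (Finset.mem_filter.1 hk).2
    rw [hk']
    congr 1
    obtain ⟨τ, hτ⟩ := exists_perm_of_map_eq k k0 hk'
    apply Finset.card_bij' (fun σ _ => τ * σ) (fun σ _ => τ⁻¹ * σ)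
    · intro σ hσ
      simp only [Finset.mem_filter, Finset.mem_univ, true_and] at hσ ⊢
      rw [Equiv.Perm.coe_mul, ← Function.comp_assoc, hτ, hσ]
    · intro σ hσ
      simp only [Finset.mem_filter, Finset.mem_univ, true_and] at hσ ⊢
      have : k ∘ (τ⁻¹ : Equiv.Perm (Fin n)) = k0 := by
        rw [← hτ]; funext i; simp
      rw [Equiv.Perm.coe_mul, ← Function.comp_assoc, this, hσ]
    · intro σ _; simp
    · intro σ _; simp
  rw [h1, ← Finset.sum_smul]
  congr 1
  rw [← Finset.card_eq_sum_card_fiberwise (f := fun σ : Equiv.Perm (Fin n) => k0 ∘ σ)]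
  · rw [Finset.card_univ, Fintype.card_perm, Fintype.card_fin]
  · intro σ _
    simp only [Finset.coe_filter]
    exact ⟨hs _ hk0 _, ms_comp _ _⟩

open Classical in
noncomputable def TT (N c : ℕ) (o : Prop) : Finset (Multiset (Fin N)) :=
  if o then (Finset.univ.powersetCard c).image Finset.val
  else (Finset.univ : Finset (Sym (Fin N) c)).image (fun s : Sym (Fin N) c => (s : Multiset (Fin N)))

lemma mem_TT (N c : ℕ) (o : Prop) (L : Multiset (Fin N)) :
    L ∈ TT N c o ↔ Multiset.card L = c ∧ (o → L.Nodup) := by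
  unfold TT
  split_ifs with h
  · simp only [Finset.mem_image, Finset.mem_powersetCard, h, true_imp_iff]
    constructor
    · rintro ⟨a, ⟨_, rfl⟩, rfl⟩
      exact ⟨rfl, a.nodup⟩
    · rintro ⟨rfl, hn⟩
      exact ⟨⟨L, hn⟩, ⟨Finset.subset_univ _, rfl⟩, rfl⟩
  · simp only [Finset.mem_image, Finset.mem_univ, true_and, h, false_imp_iff, and_true]
    constructor
    · rintro ⟨a, rfl⟩
      exact a.2
    · intro hL
      exact ⟨⟨L, hL⟩, rfl⟩

noncomputable def eh (N c : ℕ) (o : Prop) : MvPolynomial (Fin N) ℚ :=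
  ∑ L ∈ TT N c o, (L.map MvPolynomial.X).prod

lemma eh_odd (N c : ℕ) (o : Prop) (h : o) : eh N c o = eN N c := by
  rw [eh, TT, if_pos h, Finset.sum_image (fun _ _ _ _ h => Finset.val_injective h)]
  rfl

lemma eh_even (N c : ℕ) (o : Prop) (h : ¬ o) : eh N c o = hN N c := by
  rw [eh, TT, if_neg h, Finset.sum_image (fun _ _ _ _ h => Sym.coe_injective h)]
  rfl

lemma count_sum_map {A B : Type} [DecidableEq A] [DecidableEq B] (s : Finset A) (c : s → Multiset B) (a : A) (b : B) :
    Multiset.count (a, b) (∑ S : s, (c S).map (fun b => (S.1, b))) =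
      if h : a ∈ s then (c ⟨a, h⟩).count b else 0 := by
  rw [Multiset.count_sum']
  have h1 : ∀ S : s, Multiset.count (a, b) ((c S).map (fun b => (S.1, b))) = if S.1 = a then (c S).count b else 0 := by
    intro S
    split_ifs with h
    · subst h
      exact Multiset.count_map_eq_count' (fun b => (S.1, b)) _ (fun _ _ h => (Prod.ext_iff.1 h).2) b
    · rw [Multiset.count_eq_zero]
      intro hm
      obtain ⟨b', _, hb⟩ := Multiset.mem_map.1 hm
      exact h (Prod.ext_iff.1 hb).1
  simp only [h1]
  split_ifs with h
  · rw [Finset.sum_eq_single ⟨a, h⟩]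
    · simp
    · intro S _ hS
      rw [if_neg]
      intro h'; exact hS (Subtype.ext h')
    · simp
  · apply Finset.sum_eq_zero
    intro S _
    rw [if_neg]
    rintro rfl
    exact h S.2

lemma count_filter_snd {A B : Type} [DecidableEq A] [DecidableEq B] (K : Multiset (A × B)) (a : A) (b : B) :
    Multiset.count b ((K.filter (fun v => v.1 = a)).map Prod.snd) = K.count (a, b) := by
  rw [Multiset.count_map, Multiset.filter_filter, ← Multiset.countP_eq_card_filter, Multiset.count]
  apply Multiset.countP_congr rfl
  intro v _
  simp [Prod.ext_iff, eq_comm, and_comm]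

lemma prod_eh {A : Type} [DecidableEq A] (N : ℕ) (o : A → Prop) (M : Multiset A) (Ks : Finset (Multiset (A × Fin N)))
    (hKs : ∀ K, K ∈ Ks ↔ K.map Prod.fst = M ∧ ∀ v : A × Fin N, o v.1 → K.count v ≤ 1) :
    ∑ K ∈ Ks, (K.map (fun v => MvPolynomial.X (R := ℚ) v.2)).prod =
      ∏ S ∈ M.toFinset, eh N (M.count S) (o S) := by
  unfold eh
  rw [← Finset.prod_coe_sort, Finset.prod_univ_sum]
  symm
  refine Finset.sum_bij (fun c _ => ∑ S : M.toFinset, (c S).map (fun b => (S.1, b))) ?_ ?_ ?_ ?_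
  · intro c hc
    have hc' : ∀ S, Multiset.card (c S) = M.count S.1 ∧ (o S.1 → (c S).Nodup) := fun S => (mem_TT _ _ _ _).1 (Fintype.mem_piFinset.1 hc S)
    rw [hKs]
    constructor
    · change Multiset.mapAddMonoidHom Prod.fst _ = M
      rw [map_sum]
      have : ∀ S : M.toFinset, Multiset.mapAddMonoidHom Prod.fst ((c S).map (fun b => (S.1, b))) = M.count S.1 • {S.1} := by
        intro S
        change Multiset.map Prod.fst ((c S).map (fun b => (S.1, b))) = _
        rw [Multiset.map_map, ← (hc' S).1, Multiset.nsmul_singleton]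
        exact Multiset.map_const _ _
      simp only [this]
      rw [Finset.sum_coe_sort M.toFinset (fun S => M.count S • ({S} : Multiset A))]
      exact Multiset.toFinset_sum_count_nsmul_eq M
    · rintro ⟨a, b⟩ ho
      rw [count_sum_map]
      split_ifs with h
      · exact Multiset.nodup_iff_count_le_one.1 ((hc' ⟨a, h⟩).2 ho) b
      · exact Nat.zero_le _
  · intro c _ c' _ h
    funext S
    ext b
    have := congrArg (Multiset.count (S.1, b)) h
    simp only [count_sum_map] at this
    simpa using this
  · intro K hK
    obtain ⟨h1, h2⟩ := (hKs K).1 hK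
    refine ⟨fun S => (K.filter (fun v => v.1 = S.1)).map Prod.snd, ?_, ?_⟩
    · rw [Fintype.mem_piFinset]
      intro S
      rw [mem_TT]
      constructor
      · have h3 := congrArg (Multiset.count S.1) h1
        rw [← h3, Multiset.card_map, Multiset.count_map]
        simp only [eq_comm]
      · intro ho
        rw [Multiset.nodup_iff_count_le_one]
        intro b
        rw [count_filter_snd]
        exact h2 (S.1, b) ho
    · ext ⟨a, b⟩
      rw [count_sum_map]
      split_ifs with h
      · rw [count_filter_snd]
      · symm
        rw [Multiset.count_eq_zero]
        intro hm
        apply h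
        rw [Multiset.mem_toFinset, ← h1]
        exact Multiset.mem_map_of_mem Prod.fst hm
  · intro c _
    have : ∀ (t : Finset M.toFinset), ((∑ S ∈ t, (c S).map (fun b => (S.1, b))).map (fun v => MvPolynomial.X (R := ℚ) v.2)).prod = ∏ S ∈ t, ((c S).map MvPolynomial.X).prod := by
      intro t
      induction t using Finset.induction_on with
      | empty => simp
      | insert S t hS ih =>
        rw [Finset.sum_insert hS, Finset.prod_insert hS, Multiset.map_add, Multiset.prod_add, ih, Multiset.map_map]
        rfl
    exact (this Finset.univ).symm

lemma good_iff {n m m' : ℕ} {W : Type} [DecidableEq W] (k : Fin n → CMS m m' × W) :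
    Good k ↔ ∀ v : CMS m m' × W, Odd v.1.2.card → (ms k).count v ≤ 1 := by
  have hc : ∀ v, (ms k).count v = (Finset.univ.filter (fun a => v = k a)).card := by
    intro v
    rw [ms, Multiset.count_map]; rfl
  constructor
  · intro h v hv
    rw [hc, Finset.card_le_one]
    intro a ha b hb
    by_contra hab
    simp only [Finset.mem_filter, Finset.mem_univ, true_and] at ha hb
    have := h a b hab (ha.symm.trans hb)
    rw [← ha] at this
    exact Nat.not_even_iff_odd.2 hv this
  · intro h a b hab hk
    by_contra hodd
    have := h (k a) (Nat.not_even_iff_odd.1 hodd)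
    rw [hc, Finset.card_le_one] at this
    exact hab (this a (by simp) b (by simp [hk]))

lemma ctIs_iff {n m m' : ℕ} (α : Fin m → ℕ) (β : Fin m' → ℕ) (f : Fin n → CMS m m') :
    CtIs α β f ↔ ContentIs (ms f) α β := by
  unfold CtIs ContentIs
  simp only [ms, Multiset.map_map]
  rfl

lemma exists_ms {n : ℕ} {V : Type} (K : Multiset V) (h : Multiset.card K = n) : ∃ k : Fin n → V, ms k = K := by
  subst h
  induction K using Quotient.inductionOn with
  | h l =>
    refine ⟨fun i => l.get i, ?_⟩
    rw [ms, Fin.univ_val_map]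
    exact congrArg _ (List.ofFn_get l)


open Classical in
lemma lhs_eq (n N : ℕ) (χ : n.Partition → ℤ) (c : Equiv.Perm (Fin n) → ℤ)
    (hc : ∀ (μ : n.Partition) (σ : Equiv.Perm (Fin n)), σ.partition.parts = μ.parts → c σ = χ μ) :
    (n.factorial : MvPolynomial (Fin N) ℚ) * ∑ μ : Nat.Partition n,
        MvPolynomial.C ((χ μ : ℚ) / (zPart μ : ℚ)) * (μ.parts.map (pN N)).prod =
      ∑ σ : Equiv.Perm (Fin n), (c σ : MvPolynomial (Fin N) ℚ) * (σ.partition.parts.map (pN N)).prod := by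
  let tp : Equiv.Perm (Fin n) → n.Partition := fun σ =>
    ⟨σ.partition.parts, σ.partition.parts_pos, by simpa using σ.partition.parts_sum⟩
  rw [← Finset.sum_fiberwise_of_maps_to (g := tp) (t := Finset.univ) (fun _ _ => Finset.mem_univ _), Finset.mul_sum]
  apply Finset.sum_congr rfl
  intro μ _
  have hiff : ∀ σ, tp σ = μ ↔ σ.partition.parts = μ.parts := fun σ => Nat.Partition.ext_iff
  have h1 : ∀ σ ∈ Finset.univ.filter (fun σ => tp σ = μ), (c σ : MvPolynomial (Fin N) ℚ) * (σ.partition.parts.map (pN N)).prod = (χ μ : MvPolynomial (Fin N) ℚ) * (μ.parts.map (pN N)).prod := by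
    intro σ hσ
    have h2 := (hiff σ).1 (Finset.mem_filter.1 hσ).2
    rw [hc μ σ h2, h2]
  rw [Finset.sum_congr rfl h1, Finset.sum_const, nsmul_eq_mul, ← mul_assoc, ← mul_assoc]
  congr 1
  have hz := zcount μ
  have hcard : (Finset.univ.filter (fun σ => tp σ = μ)).card = (Finset.univ.filter (fun σ : Equiv.Perm (Fin n) => σ.partition.parts = μ.parts)).card := by
    congr 1
    ext σ
    simp only [Finset.mem_filter, hiff]
  rw [hcard, ← hz]
  have hz0 : (zPart μ : ℚ) ≠ 0 := by
    intro h0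
    have : zPart μ = 0 := by exact_mod_cast h0
    rw [this, mul_zero] at hz
    exact (Nat.factorial_ne_zero n) hz.symm
  have e1 : ∀ x : ℕ, (x : MvPolynomial (Fin N) ℚ) = MvPolynomial.C (x : ℚ) := fun x => by simp
  have e2 : ∀ x : ℤ, (x : MvPolynomial (Fin N) ℚ) = MvPolynomial.C (x : ℚ) := fun x => by simp
  rw [e1, e1, e2, ← MvPolynomial.C_mul, ← MvPolynomial.C_mul]
  congr 1
  push_cast
  field_simp

def pairUp {n m m' N : ℕ} (f : Fin n → CMS m m') (g : Fin n → Fin N) : Fin n → CMS m m' × Fin N :=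
  fun i => (f i, g i)

open Classical in
noncomputable def goodSet (n : ℕ) {m m' : ℕ} (N : ℕ) (α : Fin m → ℕ) (β : Fin m' → ℕ) :
    Finset (Fin n → CMS m m' × Fin N) :=
  ((Finset.univ : Finset (XX n α β × (Fin n → Fin N))).image (fun p => pairUp p.1.1 p.2)).filter Good

open Classical in
noncomputable def stabC {n : ℕ} {V : Type} (k : Fin n → V) : ℕ :=
  (Finset.univ.filter (fun σ : Equiv.Perm (Fin n) => k ∘ σ = k)).card

open Classical in
noncomputable def sg {n m m' : ℕ} {W : Type} (σ : Equiv.Perm (Fin n)) (k : Fin n → CMS m m' × W) : ℤ :=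
  if k ∘ σ = k then sgn σ (Prod.fst ∘ k) else 0

lemma sg_pos {n m m' : ℕ} {W : Type} (σ : Equiv.Perm (Fin n)) (k : Fin n → CMS m m' × W) (h : k ∘ σ = k) :
    sg σ k = sgn σ (Prod.fst ∘ k) := by rw [sg, if_pos h]

lemma sg_neg {n m m' : ℕ} {W : Type} (σ : Equiv.Perm (Fin n)) (k : Fin n → CMS m m' × W) (h : ¬ k ∘ σ = k) :
    sg σ k = 0 := by rw [sg, if_neg h]

lemma sg_good {n m m' : ℕ} {W : Type} (k : Fin n → CMS m m' × W) (h : Good k) :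
    ∑ σ : Equiv.Perm (Fin n), sg σ k = (stabC k : ℤ) := by
  classical
  have := sgn_sum k
  rw [if_pos h] at this
  unfold sg stabC
  convert this

lemma sg_bad {n m m' : ℕ} {W : Type} (k : Fin n → CMS m m' × W) (h : ¬ Good k) :
    ∑ σ : Equiv.Perm (Fin n), sg σ k = 0 := by
  classical
  have := sgn_sum k
  rw [if_neg h] at this
  unfold sg
  convert this

open Classical in
lemma orbit_count' {n : ℕ} {V A : Type} [AddCommMonoid A] (s : Finset (Fin n → V))
    (hs : ∀ k ∈ s, ∀ σ : Equiv.Perm (Fin n), k ∘ σ ∈ s) (w : Multiset V → A)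
    (T : Finset (Multiset V)) (hT : ∀ K, K ∈ T ↔ ∃ k ∈ s, ms k = K) :
    ∑ k ∈ s, stabC k • w (ms k) = n.factorial • ∑ K ∈ T, w K := by
  have := orbit_count s hs w
  have hT' : T = s.image ms := by
    ext K; rw [hT, Finset.mem_image]
  rw [hT']
  unfold stabC
  convert this

lemma mem_goodSet (n : ℕ) {m m' : ℕ} (N : ℕ) (α : Fin m → ℕ) (β : Fin m' → ℕ) (k : Fin n → CMS m m' × Fin N) :
    k ∈ goodSet n N α β ↔ ContentIs ((ms k).map Prod.fst) α β ∧
      ∀ v : CMS m m' × Fin N, Odd v.1.2.card → (ms k).count v ≤ 1 := by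
  have hm : (ms k).map Prod.fst = ms (Prod.fst ∘ k) := by rw [ms, Multiset.map_map]
  unfold goodSet
  classical
  refine (@Finset.mem_filter _ _ (_) _ _).trans ?_
  rw [good_iff, hm, ← ctIs_iff]
  apply and_congr_left'
  rw [Finset.mem_image]
  constructor
  · rintro ⟨⟨f, g⟩, _, rfl⟩
    exact f.2
  · intro h
    exact ⟨(⟨Prod.fst ∘ k, h⟩, Prod.snd ∘ k), Finset.mem_univ _, rfl⟩

open Classical in
lemma mid_eq (n : ℕ) {m m' : ℕ} (N : ℕ) (α : Fin m → ℕ) (β : Fin m' → ℕ) :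
    ∑ σ : Equiv.Perm (Fin n), ((∑ f : XX n α β, if f.1 ∘ σ = f.1 then sgn σ f.1 else 0 : ℤ) : MvPolynomial (Fin N) ℚ) * (σ.partition.parts.map (pN N)).prod
    = ∑ k ∈ goodSet n N α β, stabC k •
        ((ms k).map (fun v => MvPolynomial.X (R := ℚ) v.2)).prod := by
  have hfix : ∀ (f : Fin n → CMS m m') (g : Fin n → Fin N) (σ : Equiv.Perm (Fin n)),
      pairUp f g ∘ σ = pairUp f g ↔ f ∘ σ = f ∧ g ∘ σ = g := by
    intro f g σ
    simp only [funext_iff, pairUp, Function.comp_apply, Prod.ext_iff (x := (_, _)), forall_and]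
  have h1 : ∀ σ : Equiv.Perm (Fin n), ((∑ f : XX n α β, if f.1 ∘ σ = f.1 then sgn σ f.1 else 0 : ℤ) : MvPolynomial (Fin N) ℚ) * (σ.partition.parts.map (pN N)).prod
      = ∑ p : XX n α β × (Fin n → Fin N), (sg σ (pairUp p.1.1 p.2) : MvPolynomial (Fin N) ℚ) * ∏ i, MvPolynomial.X (R := ℚ) (p.2 i) := by
    intro σ
    rw [psum_prod, Fintype.sum_prod_type, Int.cast_sum, Finset.sum_mul]
    apply Finset.sum_congr rfl
    intro f _
    rw [Finset.mul_sum]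
    apply Finset.sum_congr rfl
    intro g _
    by_cases hf : f.1 ∘ σ = f.1
    · by_cases hg : g ∘ σ = g
      · rw [if_pos hf, if_pos hg, sg_pos _ _ ((hfix _ _ _).2 ⟨hf, hg⟩)]; rfl
      · rw [if_neg hg, sg_neg _ _ (fun h => hg ((hfix _ _ _).1 h).2)]; simp
    · rw [if_neg hf, sg_neg _ _ (fun h => hf ((hfix _ _ _).1 h).1)]; simp
  rw [Finset.sum_congr rfl (fun σ _ => h1 σ), Finset.sum_comm]
  rw [goodSet, Finset.sum_filter, Finset.sum_image]
  · apply Finset.sum_congr rfl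
    rintro ⟨f, g⟩ _
    rw [← Finset.sum_mul, ← Int.cast_sum]
    have h4 : ((ms (pairUp f.1 g)).map (fun v => MvPolynomial.X (R := ℚ) v.2)).prod = ∏ i, MvPolynomial.X (R := ℚ) (g i) := by
      rw [ms, Multiset.map_map]; rfl
    rw [h4]
    by_cases hG : Good (pairUp f.1 g)
    · rw [if_pos hG, sg_good _ hG, nsmul_eq_mul, Int.cast_natCast]
    · rw [if_neg hG, sg_bad _ hG, Int.cast_zero, zero_mul]
  · rintro ⟨f, g⟩ _ ⟨f', g'⟩ _ h
    have : ∀ i, f.1 i = f'.1 i ∧ g i = g' i := fun i => Prod.ext_iff.1 (congrFun h i)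
    exact Prod.ext (Subtype.ext (funext fun i => (this i).1)) (funext fun i => (this i).2)

lemma hN_zero (N : ℕ) : hN N 0 = 1 := by
  rw [← eh_even N 0 False id, eh]
  have : TT N 0 False = {0} := by
    ext L
    rw [mem_TT]; simp
  rw [this]; simp

lemma eN_zero (N : ℕ) : eN N 0 = 1 := by
  simp [eN]

lemma rhs_term {m m' : ℕ} (n N : ℕ) (π : Multiset (CMS m m')) (h : ∀ P ∈ π, 0 < CMS.size P) (c : ℕ) :
    hN N c *
          (∏ S ∈ π.toFinset.filter (fun S => Even S.2.card), hN N (π.count S)) *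
          (∏ S ∈ π.toFinset.filter (fun S => Odd S.2.card), eN N (π.count S)) =
    ∏ S ∈ (π + Multiset.replicate c ((0, ∅) : CMS m m')).toFinset,
      eh N ((π + Multiset.replicate c ((0, ∅) : CMS m m')).count S) (Odd S.2.card) := by
  set z : CMS m m' := (0, ∅) with hz
  have hzπ : z ∉ π := fun hm => by
    have := h z hm
    simp [CMS.size, hz] at this
  have h1 : ∏ S ∈ (π + Multiset.replicate c z).toFinset, eh N ((π + Multiset.replicate c z).count S) (Odd S.2.card)
     = ∏ S ∈ insert z π.toFinset, eh N ((π + Multiset.replicate c z).count S) (Odd S.2.card) := by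
    apply Finset.prod_subset
    · intro S hS
      rw [Multiset.mem_toFinset, Multiset.mem_add] at hS
      rcases hS with hS | hS
      · exact Finset.mem_insert_of_mem (Multiset.mem_toFinset.2 hS)
      · rw [Multiset.eq_of_mem_replicate hS]; exact Finset.mem_insert_self _ _
    · intro S _ hS
      rw [Multiset.mem_toFinset] at hS
      rw [Multiset.count_eq_zero_of_notMem hS]
      by_cases ho : Odd S.2.card
      · rw [eh_odd _ _ _ ho, eN_zero]
      · rw [eh_even _ _ _ ho, hN_zero]
  rw [h1, Finset.prod_insert (by simpa using hzπ), eh_even N _ (Odd z.2.card) (by simp [hz]), mul_assoc]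
  congr 1
  · rw [Multiset.count_add, Multiset.count_eq_zero_of_notMem hzπ, Multiset.count_replicate_self, zero_add]
  · rw [← Finset.prod_filter_mul_prod_filter_not π.toFinset (fun S => Even S.2.card)]
    have hcnt : ∀ S ∈ π.toFinset, (π + Multiset.replicate c z).count S = π.count S := by
      intro S hS
      rw [Multiset.mem_toFinset] at hS
      rw [Multiset.count_add, Multiset.count_replicate, if_neg, add_zero]
      rintro rfl; exact hzπ hS
    simp only [Nat.not_even_iff_odd]
    congr 1
    · apply Finset.prod_congr rfl
      intro S hS
      rw [Finset.mem_filter] at hS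
      rw [hcnt S hS.1, eh_even _ _ _ (Nat.not_odd_iff_even.2 hS.2)]
    · apply Finset.prod_congr rfl
      intro S hS
      rw [Finset.mem_filter] at hS
      rw [hcnt S hS.1, eh_odd _ _ _ hS.2]

lemma size_pos_iff {m m' : ℕ} (P : CMS m m') : 0 < CMS.size P ↔ P ≠ (0, ∅) := by
  rw [← not_iff_not]
  simp only [not_lt, Nat.le_zero, CMS.size, Nat.add_eq_zero_iff, Finset.sum_eq_zero_iff, Finset.card_eq_zero, Prod.ext_iff, funext_iff, not_not, ne_eq]
  simp

lemma contentIs_add {m m' : ℕ} (π : Multiset (CMS m m')) (c : ℕ) (α : Fin m → ℕ) (β : Fin m' → ℕ) :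
    ContentIs (π + Multiset.replicate c ((0, ∅) : CMS m m')) α β ↔ ContentIs π α β := by
  simp [ContentIs]

lemma split_zero {m m' : ℕ} (M : Multiset (CMS m m')) :
    ∃ (π : Multiset (CMS m m')) (c : ℕ), (∀ P ∈ π, P ≠ (0, ∅)) ∧ M = π + Multiset.replicate c (0, ∅) := by
  refine ⟨M.filter (fun P => P ≠ (0, ∅)), M.count (0, ∅), fun P hP => (Multiset.mem_filter.1 hP).2, ?_⟩
  show M = M.filter (fun P => P ≠ (0, ∅)) + Multiset.replicate (M.count (0, ∅)) (0, ∅)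
  conv_lhs => rw [← Multiset.filter_add_not (fun P => P ≠ (0, ∅)) M]
  congr 1
  simp only [ne_eq, not_not]
  exact Multiset.filter_eq' M (0, ∅)

lemma rhs_eq (n : ℕ) {m m' : ℕ} (N : ℕ) (α : Fin m → ℕ) (β : Fin m' → ℕ) (t : Finset (Multiset (CMS m m')))
    (ht : ∀ M, M ∈ t ↔ ContentIs M α β ∧ Multiset.card M = n) :
    ∑ᶠ π ∈ {π : Multiset (CMS m m') |
          (∀ P ∈ π, 0 < CMS.size P) ∧ ContentIs π α β ∧ Multiset.card π ≤ n},
        hN N (n - Multiset.card π) *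
          (∏ S ∈ π.toFinset.filter (fun S => Even S.2.card), hN N (π.count S)) *
          (∏ S ∈ π.toFinset.filter (fun S => Odd S.2.card), eN N (π.count S)) =
    ∑ M ∈ t, ∏ S ∈ M.toFinset, eh N (M.count S) (Odd S.2.card) := by
  rw [← finsum_mem_coe_finset]
  apply finsum_mem_eq_of_bijOn (fun π => π + Multiset.replicate (n - Multiset.card π) ((0, ∅) : CMS m m'))
  · refine ⟨?_, ?_, ?_⟩
    · rintro π ⟨h1, h2, h3⟩
      rw [Finset.mem_coe, ht, contentIs_add]
      refine ⟨h2, ?_⟩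
      rw [Multiset.card_add, Multiset.card_replicate]
      omega
    · rintro π ⟨h1, _⟩ π' ⟨h1', _⟩ h
      have key : ∀ (π : Multiset (CMS m m')) (c : ℕ), (∀ P ∈ π, 0 < CMS.size P) →
          (π + Multiset.replicate c ((0, ∅) : CMS m m')).filter (fun P => P ≠ (0, ∅)) = π := by
        intro π c hπ
        rw [Multiset.filter_add, Multiset.filter_eq_self.2 (fun P hP => (size_pos_iff P).1 (hπ P hP)), Multiset.filter_eq_nil.2, add_zero]
        intro P hP
        rw [Multiset.eq_of_mem_replicate hP]; simp
      have := congrArg (Multiset.filter (fun P => P ≠ (0, ∅))) h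
      simp only at this
      rwa [key _ _ h1, key _ _ h1'] at this
    · intro M hM
      rw [Finset.mem_coe, ht] at hM
      obtain ⟨π, c, hπ, rfl⟩ := split_zero M
      have hcard := hM.2
      rw [Multiset.card_add, Multiset.card_replicate] at hcard
      refine ⟨π, ⟨fun P hP => (size_pos_iff P).2 (hπ P hP), (contentIs_add π c α β).1 hM.1, by omega⟩, ?_⟩
      have hc : n - Multiset.card π = c := by omega
      simp only [hc]
  · rintro π ⟨h1, _⟩
    exact rhs_term n N π h1 _

/-- Let `χ_{α,β}(μ)` be the (integer) trace of the action of a permutation of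
cycle type `μ` on `R_{α,β}`.  Then in `ℚ[y_1,…,y_N]`,
`Σ_{μ ⊢ n} χ_{α,β}(μ)·p_μ/z_μ = Σ_π h_{n−ℓ(π)}·h_{m̃e(π)}·e_{m̃o(π)}`, where `π` runs over the
multiset partitions of content `cont_{α,β}` of length at most `n`. -/
theorem frobenius_image_component (n m m' N : ℕ) (hn : 0 < n) (hm : 0 < m) (hm' : 0 < m')
    (hN' : 0 < N) (α : Fin m → ℕ) (β : Fin m' → ℕ)
    (hstab : ∀ σ : Equiv.Perm (Fin n),
      ∀ z ∈ component n m m' α β, @act n m m' σ z ∈ component n m m' α β)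
    (χ : (Nat.Partition n) → ℤ)
    (hχ : ∀ (μ : Nat.Partition n) (σ : Equiv.Perm (Fin n)), σ.partition.parts = μ.parts →
      LinearMap.trace ℂ (component n m m' α β)
          (LinearMap.restrict (@act n m m' σ).toLinearMap (hstab σ)) = (χ μ : ℂ)) :
    ∑ μ : Nat.Partition n,
        MvPolynomial.C ((χ μ : ℚ) / (zPart μ : ℚ)) * (μ.parts.map (pN N)).prod =
      ∑ᶠ π ∈ {π : Multiset (CMS m m') |
          (∀ P ∈ π, 0 < CMS.size P) ∧ ContentIs π α β ∧ Multiset.card π ≤ n},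
        hN N (n - Multiset.card π) *
          (∏ S ∈ π.toFinset.filter (fun S => Even S.2.card), hN N (π.count S)) *
          (∏ S ∈ π.toFinset.filter (fun S => Odd S.2.card), eN N (π.count S)) := by
  classical
  have hc : ∀ (μ : n.Partition) (σ : Equiv.Perm (Fin n)), σ.partition.parts = μ.parts →
      (∑ f : XX n α β, if f.1 ∘ σ = f.1 then sgn σ f.1 else 0 : ℤ) = χ μ := by
    intro μ σ h
    have := hχ μ σ h
    rw [trace_eq] at this
    exact_mod_cast this
  have hL := lhs_eq n N χ _ hc
  have hmid := mid_eq n N α β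
  have horb := orbit_count' (goodSet n N α β) (by
    intro k hk σ
    rw [mem_goodSet] at hk ⊢
    rwa [ms_comp]) (fun K => (K.map (fun v => MvPolynomial.X (R := ℚ) v.2)).prod)
    ((goodSet n N α β).image ms) (fun K => Finset.mem_image)
  have hall := hL.trans (hmid.trans horb)
  rw [nsmul_eq_mul] at hall
  have hne : (n.factorial : MvPolynomial (Fin N) ℚ) ≠ 0 := by
    exact_mod_cast Nat.factorial_ne_zero n
  rw [mul_left_cancel₀ hne hall]
  let t : Finset (Multiset (CMS m m')) := (Finset.univ : Finset (XX n α β)).image (fun f => ms f.1)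
  have ht : ∀ M, M ∈ t ↔ ContentIs M α β ∧ Multiset.card M = n := by
    intro M
    constructor
    · intro hM
      obtain ⟨f, _, rfl⟩ := Finset.mem_image.1 hM
      exact ⟨(ctIs_iff α β f.1).1 f.2, by simp [ms]⟩
    · rintro ⟨h1, h2⟩
      obtain ⟨f, rfl⟩ := exists_ms M h2
      exact Finset.mem_image.2 ⟨⟨f, (ctIs_iff α β f).2 h1⟩, Finset.mem_univ _, rfl⟩
  rw [rhs_eq n N α β t ht]
  rw [← Finset.sum_fiberwise_of_maps_to (g := fun K : Multiset (CMS m m' × Fin N) => K.map Prod.fst) (t := t)]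
  · apply Finset.sum_congr rfl
    intro M hM
    apply prod_eh N (fun S : CMS m m' => Odd S.2.card) M
    intro K
    rw [Finset.mem_filter, Finset.mem_image]
    obtain ⟨hM1, hM2⟩ := (ht M).1 hM
    constructor
    · rintro ⟨⟨k, hk, rfl⟩, h⟩
      exact ⟨h, ((mem_goodSet _ _ _ _ _).1 hk).2⟩
    · rintro ⟨h1, h2⟩
      refine ⟨?_, h1⟩
      obtain ⟨k, rfl⟩ := exists_ms K (n := n) (by rw [← hM2, ← h1, Multiset.card_map])
      refine ⟨k, (mem_goodSet _ _ _ _ _).2 ⟨by rw [h1]; exact hM1, h2⟩, rfl⟩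
  · intro K hK
    obtain ⟨k, hk, rfl⟩ := Finset.mem_image.1 hK
    rw [ht]
    exact ⟨((mem_goodSet _ _ _ _ _).1 hk).1, by simp [ms]⟩
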